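/- Let n ≥ 2 and let K be the Cauchy–Szegő kernel on the quaternionic Heisenberg group 𝓗^{n−1}, and set K(g,h) = K(h^{−1}·g) for g ≠ h. Then there exist constants C > 0 and c > 0 (depending only on n) such that for all g, h, h₀ ∈ 𝓗^{n−1} with g ≠ h, g ≠ h₀ and ρ(g,h₀) ≥ c·ρ(h,h₀), one has |K(g,h) − K(g,h₀)| ≤ C·ρ(h,h₀)/ρ(g,h₀)^{Q+1}, where Q = 4n+2. -/

import Mathlib

open Quaternion
noncomputable section

/-- An element of the quaternionic Heisenberg group `𝓗^m = Im ℍ × ℍ^m`,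
modelled as a pair `(t, y)` with `t : ℍ` (required to be purely imaginary via
the hypothesis `t.re = 0` in the theorems below) and `y : Fin m → ℍ`. -/
abbrev QH (m : ℕ) := ℍ[ℝ] × (Fin m → ℍ[ℝ])

/-- The group product `(t,y)·(t',y') = (t + t' + 2 Im⟨y,y'⟩, y + y')`, where
`⟨y,y'⟩ = Σ_l conj(y_l)·y'_l`. -/
def qmul {m : ℕ} (g h : QH m) : QH m :=
  (g.1 + h.1 + 2 * (∑ l, star (g.2 l) * h.2 l).im, g.2 + h.2)

/-- The group inverse `(t,y)⁻¹ = (−t,−y)`. -/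
def qinv {m : ℕ} (g : QH m) : QH m := (-g.1, -g.2)

/-- The homogeneous norm `‖(t,y)‖ = (|y|⁴ + |t|²)^{1/4}`. -/
def hnorm {m : ℕ} (g : QH m) : ℝ :=
  ((∑ l, ‖g.2 l‖ ^ 2) ^ 2 + ‖g.1‖ ^ 2) ^ ((1 : ℝ) / 4)

/-- The quasi-distance `ρ(h,g) = ‖g⁻¹·h‖`. -/
def qdist {m : ℕ} (h g : QH m) : ℝ := hnorm (qmul (qinv g) h)

/-- The dilation `δ_r(t,y) = (r²t, ry)`. -/
def qdil {m : ℕ} (r : ℝ) (g : QH m) : QH m := ((r ^ 2 : ℝ) • g.1, r • g.2)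

/-- The normalized Cauchy–Szegő kernel density: `s(σ)` is the `(2n−2)`-nd
derivative at `x = Re σ` of `x ↦ conj(x + Im σ)·(x² + |Im σ|²)^{−2}`
(i.e. `∂^{2(n−1)}/∂x₁^{2(n−1)}[conj σ/|σ|⁴]` with `c_{n−1} = 1`). -/
def sker (n : ℕ) (σ : ℍ[ℝ]) : ℍ[ℝ] :=
  iteratedDeriv (2 * n - 2)
    (fun x : ℝ => ((x ^ 2 + ‖σ.im‖ ^ 2) ^ 2)⁻¹ • star ((x : ℍ[ℝ]) + σ.im)) σ.re

/-- The Cauchy–Szegő kernel `K(t,y) = s(|y|² + t)` on `𝓗^m`. -/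
def Kker (n : ℕ) {m : ℕ} (g : QH m) : ℍ[ℝ] :=
  sker n (((∑ l, ‖g.2 l‖ ^ 2 : ℝ) : ℍ[ℝ]) + g.1)

/-- The density `conj σ / |σ|⁴` and its successive derivatives in the real direction. -/
def realDirDeriv : ℕ → ℍ[ℝ] → ℍ[ℝ]
  | 0 => fun σ => ((‖σ‖ ^ 2) ^ 2)⁻¹ • star σ
  | k + 1 => fun σ => fderiv ℝ (realDirDeriv k) σ 1

lemma contDiffOn_realDirDeriv (k : ℕ) :
    ContDiffOn ℝ (⊤ : ℕ∞) (realDirDeriv k) {0}ᶜ := by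
  induction k with
  | zero =>
    have h1 : ContDiff ℝ (⊤ : ℕ∞) fun σ : ℍ[ℝ] => (‖σ‖ ^ 2) ^ 2 := (contDiff_norm_sq ℝ).pow 2
    have : StarModule ℝ ℍ[ℝ] := ⟨fun r a => by rw [Quaternion.star_smul, star_trivial r]⟩
    have h2 : ContDiff ℝ (⊤ : ℕ∞) fun σ : ℍ[ℝ] => star σ :=
      (starL' ℝ : ℍ[ℝ] ≃L[ℝ] ℍ[ℝ]).contDiff
    refine (h1.contDiffOn.inv fun σ hσ => ?_).smul h2.contDiffOn
    have : σ ≠ 0 := hσ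
    positivity
  | succ k ih =>
    exact (ih.fderiv_of_isOpen isOpen_compl_singleton (by simp)).clm_apply contDiffOn_const

lemma norm_sq_coe_add_im (x : ℝ) (σ : ℍ[ℝ]) :
    ‖(x : ℍ[ℝ]) + σ.im‖ ^ 2 = x ^ 2 + ‖σ.im‖ ^ 2 := by
  simp only [← Quaternion.normSq_eq_norm_mul_self, pow_two, Quaternion.normSq_def']
  simp
  ring

lemma iteratedDeriv_eq_realDirDeriv (k : ℕ) (σ : ℍ[ℝ]) (x : ℝ) (hx : (x : ℍ[ℝ]) + σ.im ≠ 0) :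
    iteratedDeriv k
      (fun x : ℝ => ((x ^ 2 + ‖σ.im‖ ^ 2) ^ 2)⁻¹ • star ((x : ℍ[ℝ]) + σ.im)) x =
      realDirDeriv k ((x : ℍ[ℝ]) + σ.im) := by
  induction k generalizing x with
  | zero => simp only [iteratedDeriv_zero, realDirDeriv, norm_sq_coe_add_im]
  | succ k ih =>
    have hline : HasDerivAt (fun x : ℝ => (x : ℍ[ℝ]) + σ.im) 1 x := by
      have h := ((hasDerivAt_id x).smul_const (1 : ℍ[ℝ])).add_const σ.im
      rw [one_smul] at h
      refine h.congr_of_eventuallyEq (Filter.Eventually.of_forall fun y => ?_)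
      simp only [id, ← Quaternion.coe_mul_eq_smul, mul_one]
    have hev : iteratedDeriv k
        (fun x : ℝ => ((x ^ 2 + ‖σ.im‖ ^ 2) ^ 2)⁻¹ • star ((x : ℍ[ℝ]) + σ.im)) =ᶠ[nhds x]
        fun x => realDirDeriv k ((x : ℍ[ℝ]) + σ.im) := by
      filter_upwards [hline.continuousAt.eventually_ne hx] with y hy using ih y hy
    have hd : DifferentiableAt ℝ (realDirDeriv k) ((x : ℍ[ℝ]) + σ.im) :=
      ((contDiffOn_realDirDeriv k).contDiffAt
        (isOpen_compl_singleton.mem_nhds hx)).differentiableAt (by simp)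
    rw [iteratedDeriv_succ, hev.deriv_eq]
    exact (hd.hasFDerivAt.comp_hasDerivAt x hline).deriv

lemma sker_eq_realDirDeriv (n : ℕ) {σ : ℍ[ℝ]} (hσ : σ ≠ 0) :
    sker n σ = realDirDeriv (2 * n - 2) σ := by
  have h : (σ.re : ℍ[ℝ]) + σ.im = σ := Quaternion.re_add_im σ
  rw [sker, iteratedDeriv_eq_realDirDeriv _ _ _ (by rwa [h]), h]

lemma iteratedDeriv_comp_mul_left {E : Type*} [NormedAddCommGroup E] [NormedSpace ℝ E]
    (f : ℝ → E) (r : ℝ) (k : ℕ) (x : ℝ) :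
    iteratedDeriv k (fun x => f (r * x)) x = r ^ k • iteratedDeriv k f (r * x) := by
  induction k generalizing x with
  | zero => simp
  | succ k ih =>
    rw [iteratedDeriv_succ, funext ih, deriv_fun_const_smul_field,
      deriv_comp_mul_left r (iteratedDeriv k f) x, iteratedDeriv_succ, smul_smul, pow_succ]

/-- The density `s` is homogeneous of degree `-(2n+1)`. -/
lemma sker_smul {n : ℕ} (hn : 1 ≤ n) {r : ℝ} (hr : 0 < r) (σ : ℍ[ℝ]) :
    sker n σ = r ^ (2 * n + 1) • sker n (r • σ) := by
  have him : (r • σ).im = r • σ.im := by ext <;> simp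
  have hre : (r • σ).re = r * σ.re := by simp
  have hbase : (fun x : ℝ => ((x ^ 2 + ‖σ.im‖ ^ 2) ^ 2)⁻¹ • star ((x : ℍ[ℝ]) + σ.im)) =
      fun x : ℝ => r ^ 3 • ((((r * x) ^ 2 + ‖(r • σ).im‖ ^ 2) ^ 2)⁻¹ •
        star (((r * x : ℝ) : ℍ[ℝ]) + (r • σ).im)) := by
    funext x
    have h1 : ((r * x : ℝ) : ℍ[ℝ]) + (r • σ).im = r • ((x : ℍ[ℝ]) + σ.im) := by
      ext <;> simp
    have h2 : (r * x) ^ 2 + ‖(r • σ).im‖ ^ 2 = r ^ 2 * (x ^ 2 + ‖σ.im‖ ^ 2) := by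
      rw [him, norm_smul, Real.norm_eq_abs, mul_pow, mul_pow, sq_abs, mul_add]
    rw [h1, h2, Quaternion.star_smul, smul_smul, smul_smul]
    congr 1
    rw [mul_pow, mul_inv]
    field_simp
  have hexp : 2 * n + 1 = 3 + (2 * n - 2) := by omega
  rw [sker, hbase, iteratedDeriv_fun_const_smul_field,
    iteratedDeriv_comp_mul_left (fun x : ℝ => ((x ^ 2 + ‖(r • σ).im‖ ^ 2) ^ 2)⁻¹ •
        star ((x : ℍ[ℝ]) + (r • σ).im)) r, sker, hre, smul_smul, hexp, pow_add]

lemma exists_sker_lipschitz_unit (n : ℕ) :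
    ∃ M : ℝ, 0 < M ∧ ∀ σ τ : ℍ[ℝ], ‖σ‖ = 1 → ‖τ - σ‖ ≤ 1 / 2 →
      ‖sker n τ - sker n σ‖ ≤ M * ‖τ - σ‖ := by
  have : ProperSpace ℍ[ℝ] := FiniteDimensional.proper_real _
  have hsub : Metric.closedBall (0 : ℍ[ℝ]) (3 / 2) \ Metric.ball 0 (1 / 2) ⊆ {0}ᶜ := by
    rintro σ ⟨-, h⟩ rfl
    exact h (Metric.mem_ball_self (by norm_num))
  have hcont := ((contDiffOn_realDirDeriv (2 * n - 2)).continuousOn_fderiv_of_isOpen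
    isOpen_compl_singleton (by simp)).mono hsub
  obtain ⟨M, hM⟩ := ((isCompact_closedBall (0 : ℍ[ℝ]) (3 / 2)).diff
    Metric.isOpen_ball).exists_bound_of_continuousOn hcont
  refine ⟨max M 1, by positivity, fun σ τ hσ hτ => ?_⟩
  have hball : ∀ ω ∈ Metric.closedBall σ (1 / 2),
      ω ∈ Metric.closedBall (0 : ℍ[ℝ]) (3 / 2) \ Metric.ball 0 (1 / 2) := by
    intro ω hω
    rw [mem_closedBall_iff_norm] at hω
    have h1 := norm_sub_norm_le ω σ
    have h2 := norm_sub_norm_le σ ω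
    rw [norm_sub_rev] at h2
    simp only [Set.mem_sdiff, mem_closedBall_zero_iff, mem_ball_zero_iff, not_lt]
    constructor <;> linarith
  have hσm : σ ∈ Metric.closedBall σ (1 / 2) := Metric.mem_closedBall_self (by norm_num)
  have hτm : τ ∈ Metric.closedBall σ (1 / 2) := mem_closedBall_iff_norm.2 hτ
  rw [sker_eq_realDirDeriv n (hsub (hball _ hσm)), sker_eq_realDirDeriv n (hsub (hball _ hτm))]
  refine (convex_closedBall σ (1 / 2)).norm_image_sub_le_of_norm_fderiv_le (𝕜 := ℝ)
    (fun ω hω => ?_) (fun ω hω => (hM ω (hball ω hω)).trans (le_max_left _ _)) hσm hτm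
  exact ((contDiffOn_realDirDeriv _).contDiffAt
    (isOpen_compl_singleton.mem_nhds (hsub (hball ω hω)))).differentiableAt (by simp)

lemma exists_sker_lipschitz {n : ℕ} (hn : 1 ≤ n) :
    ∃ M : ℝ, 0 < M ∧ ∀ σ τ : ℍ[ℝ], σ ≠ 0 → ‖τ - σ‖ ≤ ‖σ‖ / 2 →
      ‖sker n τ - sker n σ‖ ≤ M * ‖τ - σ‖ / ‖σ‖ ^ (2 * n + 2) := by
  obtain ⟨M, hM, H⟩ := exists_sker_lipschitz_unit n
  refine ⟨M, hM, fun σ τ hσ hτ => ?_⟩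
  have hpos : 0 < ‖σ‖ := norm_pos_iff.2 hσ
  have hr : 0 < ‖σ‖⁻¹ := inv_pos.2 hpos
  have hdist : ‖‖σ‖⁻¹ • τ - ‖σ‖⁻¹ • σ‖ = ‖σ‖⁻¹ * ‖τ - σ‖ := by
    rw [← smul_sub, norm_smul, Real.norm_of_nonneg hr.le]
  have h := H (‖σ‖⁻¹ • σ) (‖σ‖⁻¹ • τ)
    (by rw [norm_smul, Real.norm_of_nonneg hr.le, inv_mul_cancel₀ hpos.ne'])
    (by rw [hdist, inv_mul_le_iff₀ hpos]; linarith)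
  rw [sker_smul hn hr τ, sker_smul hn hr σ, ← smul_sub, norm_smul,
    Real.norm_of_nonneg (by positivity)]
  rw [hdist] at h
  calc _ ≤ ‖σ‖⁻¹ ^ (2 * n + 1) * (M * (‖σ‖⁻¹ * ‖τ - σ‖)) := by gcongr
    _ = _ := by
      rw [div_eq_mul_inv, ← inv_pow]
      ring

/-- The quaternion `|y|² + t` attached to `(t, y)`. -/
def siegel {m : ℕ} (g : QH m) : ℍ[ℝ] := ((∑ l, ‖g.2 l‖ ^ 2 : ℝ) : ℍ[ℝ]) + g.1

lemma hnorm_nonneg {m : ℕ} (g : QH m) : 0 ≤ hnorm g := by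
  unfold hnorm
  positivity

lemma hnorm_pow_four {m : ℕ} (g : QH m) :
    hnorm g ^ 4 = (∑ l, ‖g.2 l‖ ^ 2) ^ 2 + ‖g.1‖ ^ 2 := by
  rw [hnorm, ← Real.rpow_natCast, ← Real.rpow_mul (by positivity)]
  norm_num

lemma sum_norm_sq_le_hnorm_sq {m : ℕ} (g : QH m) : ∑ l, ‖g.2 l‖ ^ 2 ≤ hnorm g ^ 2 := by
  refine le_of_sq_le_sq ?_ (by positivity)
  nlinarith [hnorm_pow_four g, sq_nonneg ‖g.1‖]

lemma norm_fst_le_hnorm_sq {m : ℕ} (g : QH m) : ‖g.1‖ ≤ hnorm g ^ 2 := by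
  refine le_of_sq_le_sq ?_ (by positivity)
  nlinarith [hnorm_pow_four g, sq_nonneg (∑ l, ‖g.2 l‖ ^ 2)]

lemma norm_siegel {m : ℕ} {g : QH m} (hg : g.1.re = 0) : ‖siegel g‖ = hnorm g ^ 2 := by
  have him : g.1.im = g.1 := by ext <;> simp [hg]
  have h := norm_sq_coe_add_im (∑ l, ‖g.2 l‖ ^ 2) g.1
  rw [him, ← hnorm_pow_four] at h
  refine (sq_eq_sq₀ (norm_nonneg _) (by positivity)).1 ?_
  rw [siegel, h]
  ring

lemma im_sum {ι : Type*} (s : Finset ι) (f : ι → ℍ[ℝ]) :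
    (∑ l ∈ s, f l).im = ∑ l ∈ s, (f l).im :=
  map_sum (AddMonoidHom.mk' (fun q : ℍ[ℝ] => q.im) fun a b => by ext <;> simp) f s

lemma re_qmul {m : ℕ} {g h : QH m} (hg : g.1.re = 0) (hh : h.1.re = 0) :
    (qmul g h).1.re = 0 := by
  simp [qmul, hg, hh, two_mul]

lemma re_qinv {m : ℕ} {g : QH m} (hg : g.1.re = 0) : (qinv g).1.re = 0 := by
  simp [qinv, hg]

lemma qmul_qinv_eq {m : ℕ} (g h h₀ : QH m) :
    qmul (qinv h) g = qmul (qinv (qmul (qinv h₀) h)) (qmul (qinv h₀) g) := by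
  have hpt : ∀ a b c : ℍ[ℝ], (star (-b) * c).im =
      -(star (-a) * b).im + (star (-a) * c).im + (star (-(-a + b)) * (-a + c)).im := by
    intro a b c
    ext <;> simp <;> ring
  refine Prod.ext ?_ ?_
  · simp only [qmul, qinv, im_sum, Pi.neg_apply, Pi.add_apply]
    rw [Finset.sum_congr rfl fun l _ => hpt (h₀.2 l) (h.2 l) (g.2 l)]
    simp only [Finset.sum_add_distrib, Finset.sum_neg_distrib]
    noncomm_ring
  · simp only [qmul, qinv]
    abel

lemma norm_im_le (q : ℍ[ℝ]) : ‖q.im‖ ≤ ‖q‖ := by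
  refine le_of_sq_le_sq ?_ (norm_nonneg q)
  have h := norm_sq_coe_add_im q.re q
  rw [Quaternion.re_add_im] at h
  nlinarith [sq_nonneg q.re]

lemma sum_norm_mul_norm_le {m : ℕ} (w u : QH m) :
    ∑ l, ‖w.2 l‖ * ‖u.2 l‖ ≤ hnorm w * hnorm u := by
  refine le_of_sq_le_sq ?_ (mul_nonneg (hnorm_nonneg w) (hnorm_nonneg u))
  refine (Finset.sum_mul_sq_le_sq_mul_sq _ _ _).trans ?_
  rw [mul_pow]
  gcongr
  · exact sum_norm_sq_le_hnorm_sq w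
  · exact sum_norm_sq_le_hnorm_sq u

lemma norm_siegel_qmul_sub_le {m : ℕ} (w u : QH m) :
    ‖siegel (qmul (qinv w) u) - siegel u‖ ≤ 2 * hnorm w ^ 2 + 4 * (hnorm w * hnorm u) := by
  have hre : |∑ l, (‖-w.2 l + u.2 l‖ ^ 2 - ‖u.2 l‖ ^ 2)| ≤
      hnorm w ^ 2 + 2 * (hnorm w * hnorm u) := by
    calc _ ≤ ∑ l, (‖w.2 l‖ ^ 2 + 2 * (‖w.2 l‖ * ‖u.2 l‖)) := by
          refine (Finset.abs_sum_le_sum_abs _ _).trans (Finset.sum_le_sum fun l _ => ?_)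
          have h1 := norm_add_le (-w.2 l) (u.2 l)
          have h2 := norm_sub_norm_le (u.2 l) (w.2 l)
          have h3 := norm_sub_norm_le (w.2 l) (u.2 l)
          rw [norm_neg] at h1
          rw [norm_sub_rev] at h3
          rw [sub_eq_neg_add (u.2 l)] at h2 h3
          have h4 : (‖u.2 l‖ - ‖w.2 l‖) ^ 2 ≤ ‖-w.2 l + u.2 l‖ ^ 2 :=
            sq_le_sq' (by linarith) h2
          have := norm_nonneg (w.2 l)
          have := norm_nonneg (u.2 l)
          have := norm_nonneg (-w.2 l + u.2 l)
          rw [abs_le]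
          constructor <;> nlinarith
      _ = ∑ l, ‖w.2 l‖ ^ 2 + 2 * ∑ l, ‖w.2 l‖ * ‖u.2 l‖ := by
          rw [Finset.sum_add_distrib, Finset.mul_sum]
      _ ≤ _ := by
          linarith [sum_norm_sq_le_hnorm_sq w, sum_norm_mul_norm_le w u]
  have him : ‖(∑ l, star (-w.2 l) * u.2 l).im‖ ≤ hnorm w * hnorm u := by
    refine (norm_im_le _).trans ((norm_sum_le _ _).trans (le_trans (le_of_eq ?_)
      (sum_norm_mul_norm_le w u)))
    simp
  have hdecomp : siegel (qmul (qinv w) u) - siegel u =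
      ((∑ l, (‖-w.2 l + u.2 l‖ ^ 2 - ‖u.2 l‖ ^ 2) : ℝ) : ℍ[ℝ]) +
        (-w.1 + 2 * (∑ l, star (-w.2 l) * u.2 l).im) := by
    rw [Finset.sum_sub_distrib, Quaternion.coe_sub]
    simp only [siegel, qmul, qinv, Pi.neg_apply, Pi.add_apply]
    abel
  have h2 : ‖(2 : ℍ[ℝ])‖ = 2 := by
    rw [show (2 : ℍ[ℝ]) = ((2 : ℝ) : ℍ[ℝ]) from (map_ofNat (algebraMap ℝ ℍ[ℝ]) 2).symm,
      Quaternion.norm_coe]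
    norm_num
  rw [hdecomp]
  refine (norm_add_le _ _).trans ?_
  refine (add_le_add_right (norm_add_le _ _) _).trans ?_
  rw [Quaternion.norm_coe, norm_neg, norm_mul, h2, Real.norm_eq_abs]
  linarith [norm_fst_le_hnorm_sq w]

/-- Regularity of the Cauchy–Szegő kernel `K(g,h) = K(h⁻¹·g)` in the second
variable: there are constants `C, c > 0` (depending only on `n`) such that
whenever `ρ(g,h₀) ≥ c·ρ(h,h₀)` one has
`|K(g,h) − K(g,h₀)| ≤ C·ρ(h,h₀)/ρ(g,h₀)^{Q+1}` with `Q = 4n+2`. -/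
theorem Kker_regularity_second (n : ℕ) (hn : 2 ≤ n) :
    ∃ C : ℝ, 0 < C ∧ ∃ c : ℝ, 0 < c ∧
      ∀ g h h₀ : QH (n - 1), g.1.re = 0 → h.1.re = 0 → h₀.1.re = 0 →
        g ≠ h → g ≠ h₀ → qdist g h₀ ≥ c * qdist h h₀ →
        ‖Kker n (qmul (qinv h) g) - Kker n (qmul (qinv h₀) g)‖ ≤
          C * qdist h h₀ / qdist g h₀ ^ (4 * n + 2 + 1) := by
  obtain ⟨M, hM, H⟩ := exists_sker_lipschitz (n := n) (by omega)
  refine ⟨6 * M, by positivity, 12, by norm_num, fun g h h₀ hg hh hh₀ _ _ hc => ?_⟩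
  rw [qmul_qinv_eq g h h₀]
  simp only [qdist] at hc ⊢
  have hu := re_qmul (re_qinv hh₀) hg
  set w := qmul (qinv h₀) h
  set u := qmul (qinv h₀) g
  have hw0 := hnorm_nonneg w
  have hu0 := hnorm_nonneg u
  have hdiff : ‖siegel (qmul (qinv w) u) - siegel u‖ ≤ 6 * (hnorm w * hnorm u) := by
    nlinarith [norm_siegel_qmul_sub_le w u]
  have hnu := norm_siegel hu
  change ‖sker n (siegel (qmul (qinv w) u)) - sker n (siegel u)‖ ≤ _
  rcases hu0.eq_or_lt with hzero | hpos
  · rw [← hzero, mul_zero, mul_zero] at hdiff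
    rw [sub_eq_zero.1 (norm_le_zero_iff.1 hdiff), sub_self, norm_zero]
    positivity
  · refine (H _ _ (norm_pos_iff.1 (by rw [hnu]; positivity)) ?_).trans ?_
    · rw [hnu]
      nlinarith
    · rw [hnu, ← pow_mul, div_le_div_iff₀ (by positivity) (by positivity)]
      calc _ ≤ M * (6 * (hnorm w * hnorm u)) * hnorm u ^ (4 * n + 2 + 1) := by gcongr
        _ = _ := by ring
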